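/- If W ∼ W_n(Id, p) with n ≤ p, then E[(det W)^2] = (p!/(p−n)!)·((p+2)!/(p+2−n)!), and hence Var[det W] = (p!/(p−n)!)·((p+2)!/(p+2−n)! − p!/(p−n)!). -/

import Mathlib

open MeasureTheory ProbabilityTheory Matrix Nat

instance {m n : Type*} : MeasurableSpace (Matrix m n ℝ) :=
  inferInstanceAs (MeasurableSpace (m → n → ℝ))

/-- The Wishart distribution `W_n(Id, p)`. -/
noncomputable def wishart (n p : ℕ) : Measure (Matrix (Fin n) (Fin n) ℝ) :=
  (Measure.pi fun _ : Fin n => Measure.pi fun _ : Fin p => gaussianReal 0 1).map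
    (fun G => Matrix.of G * (Matrix.of G)ᵀ)

/-- The exponentially tilted moments of the standard Gaussian, first five. -/
lemma gauss_tilt_step (n : ℕ) (f f' : ℝ → ℝ)
    (h : ∀ t, ∫ x, x ^ n * Real.exp (t * x) ∂(gaussianReal 0 1) = f t)
    (hf : ∀ t, HasDerivAt f (f' t) t) (t : ℝ) :
    ∫ x, x ^ (n + 1) * Real.exp (t * x) ∂(gaussianReal 0 1) = f' t := by
  have h1 := hasDerivAt_integral_pow_mul_exp_real (X := id) (μ := gaussianReal 0 1) (t := t)
    (by simp [integrableExpSet_id_gaussianReal]) n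
  simp only [id] at h1
  have h2 : (fun t => ∫ x, x ^ n * Real.exp (t * x) ∂(gaussianReal 0 1)) = f := funext h
  rw [h2] at h1
  exact h1.unique (hf t)

lemma gauss_tilt_zero (t : ℝ) :
    ∫ x, x ^ 0 * Real.exp (t * x) ∂(gaussianReal 0 1) = Real.exp (t ^ 2 / 2) := by
  have := congrFun (mgf_id_gaussianReal (μ := 0) (v := 1)) t
  simpa [mgf] using this

lemma hasDerivAt_exp_sq (t : ℝ) :
    HasDerivAt (fun t : ℝ => Real.exp (t ^ 2 / 2)) (t * Real.exp (t ^ 2 / 2)) t := by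
  have := ((hasDerivAt_pow 2 t).div_const 2).exp
  convert this using 1
  simp; ring

lemma gauss_tilt_one (t : ℝ) :
    ∫ x, x ^ 1 * Real.exp (t * x) ∂(gaussianReal 0 1) = t * Real.exp (t ^ 2 / 2) :=
  gauss_tilt_step 0 _ _ gauss_tilt_zero hasDerivAt_exp_sq t

lemma gauss_tilt_two (t : ℝ) :
    ∫ x, x ^ 2 * Real.exp (t * x) ∂(gaussianReal 0 1) = (1 + t ^ 2) * Real.exp (t ^ 2 / 2) := by
  refine gauss_tilt_step 1 _ (fun t => (1 + t ^ 2) * Real.exp (t ^ 2 / 2)) gauss_tilt_one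
    (fun t => ?_) t
  exact ((hasDerivAt_id t).mul (hasDerivAt_exp_sq t)).congr_deriv (by simp; ring)

lemma gauss_tilt_three (t : ℝ) :
    ∫ x, x ^ 3 * Real.exp (t * x) ∂(gaussianReal 0 1)
      = (3 * t + t ^ 3) * Real.exp (t ^ 2 / 2) := by
  refine gauss_tilt_step 2 _ (fun t => (3 * t + t ^ 3) * Real.exp (t ^ 2 / 2)) gauss_tilt_two
    (fun t => ?_) t
  exact (((hasDerivAt_pow 2 t).const_add 1).mul (hasDerivAt_exp_sq t)).congr_deriv (by simp; ring)

lemma gauss_tilt_four (t : ℝ) :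
    ∫ x, x ^ 4 * Real.exp (t * x) ∂(gaussianReal 0 1)
      = (3 + 6 * t ^ 2 + t ^ 4) * Real.exp (t ^ 2 / 2) := by
  refine gauss_tilt_step 3 _ (fun t => (3 + 6 * t ^ 2 + t ^ 4) * Real.exp (t ^ 2 / 2))
    gauss_tilt_three (fun t => ?_) t
  exact ((((hasDerivAt_id t).const_mul 3).add (hasDerivAt_pow 3 t)).mul
    (hasDerivAt_exp_sq t)).congr_deriv (by simp; ring)

lemma gauss_m0 : ∫ x, x ^ 0 ∂(gaussianReal 0 1) = 1 := by simp
lemma gauss_m1 : ∫ x, x ^ 1 ∂(gaussianReal 0 1) = 0 := by simpa using gauss_tilt_one 0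
lemma gauss_m2 : ∫ x, x ^ 2 ∂(gaussianReal 0 1) = 1 := by simpa using gauss_tilt_two 0
lemma gauss_m3 : ∫ x, x ^ 3 ∂(gaussianReal 0 1) = 0 := by simpa using gauss_tilt_three 0
lemma gauss_m4 : ∫ x, x ^ 4 ∂(gaussianReal 0 1) = 3 := by simpa using gauss_tilt_four 0

lemma gauss_integrable_pow (k : ℕ) : Integrable (fun x : ℝ => x ^ k) (gaussianReal 0 1) := by
  have := (memLp_id_gaussianReal (μ := 0) (v := 1) (k : NNReal))
  simpa using this.integrable_norm_pow' |>.mono (by fun_prop) (by simp)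

/-- standard Gaussian on `ℝ^p` -/
noncomputable abbrev gvec (p : ℕ) : Measure (Fin p → ℝ) := Measure.pi fun _ : Fin p => gaussianReal 0 1

lemma mon4_eq {p : ℕ} (i j k l : Fin p) (x : Fin p → ℝ) :
    x i * x j * x k * x l = ∏ m, x m ^ ((if i = m then 1 else 0) + (if j = m then 1 else 0)
      + (if k = m then 1 else 0) + (if l = m then 1 else 0)) := by
  simp only [pow_add, Finset.prod_mul_distrib, pow_ite, pow_one, pow_zero]
  simp

lemma mon4_integrable {p : ℕ} (i j k l : Fin p) :
    Integrable (fun x : Fin p → ℝ => x i * x j * x k * x l) (gvec p) := by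
  simp_rw [mon4_eq]
  exact Integrable.fintype_prod (f := fun m (y : ℝ) => y ^ ((if i = m then 1 else 0)
    + (if j = m then 1 else 0) + (if k = m then 1 else 0) + (if l = m then 1 else 0)))
    (fun m => gauss_integrable_pow _)

lemma mon4_integral {p : ℕ} (i j k l : Fin p) :
    ∫ x, x i * x j * x k * x l ∂(gvec p) =
      (if i = j then 1 else 0) * (if k = l then 1 else 0)
      + (if i = k then 1 else 0) * (if j = l then 1 else 0)
      + (if i = l then 1 else 0) * (if j = k then 1 else 0) := by
  simp_rw [mon4_eq]
  rw [integral_fintype_prod_eq_prod (μ := fun _ : Fin p => gaussianReal 0 1)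
    (fun m (y : ℝ) => y ^ ((if i = m then 1 else 0)
    + (if j = m then 1 else 0) + (if k = m then 1 else 0) + (if l = m then 1 else 0)))]
  by_cases hij : i = j
  · subst hij
    by_cases hkl : k = l
    · subst hkl
      by_cases hik : i = k
      · subst hik
        rw [Finset.prod_eq_single i]
        · simp [gauss_m4]; norm_num
        · intro m _ hm; simp [hm.symm]
        · simp
      · rw [Finset.prod_eq_one]
        · simp [hik]
        · intro m _
          by_cases h1 : i = m
          · have h2 : k ≠ m := fun h => hik (h1.trans h.symm)
            simp [h1, h2, gauss_m2]
          · by_cases h2 : k = m <;> simp [h1, h2, gauss_m2]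
    · by_cases hik : i = k
      · subst hik
        rw [Finset.prod_eq_zero (Finset.mem_univ l)]
        · simp [hkl]
        · simpa [hkl] using gauss_m1
      · rw [Finset.prod_eq_zero (Finset.mem_univ k)]
        · simp [hkl, hik]
        · simpa [hik, Ne.symm hkl] using gauss_m1
  · by_cases hik : i = k
    · subst hik
      by_cases hjl : j = l
      · subst hjl
        rw [Finset.prod_eq_one]
        · simp [hij]
        · intro m _
          by_cases h1 : i = m
          · have h2 : j ≠ m := fun h => hij (h1.trans h.symm)
            simp [h1, h2, gauss_m2]
          · by_cases h2 : j = m <;> simp [h1, h2, gauss_m2]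
      · rw [Finset.prod_eq_zero (Finset.mem_univ j)]
        · simp [hij, hjl, Ne.symm hij]
        · simpa [hij, Ne.symm hjl] using gauss_m1
    · by_cases hil : i = l
      · subst hil
        by_cases hjk : j = k
        · subst hjk
          rw [Finset.prod_eq_one]
          · simp [hij]
          · intro m _
            by_cases h1 : i = m
            · have h2 : j ≠ m := fun h => hij (h1.trans h.symm)
              simp [h1, h2, gauss_m2]
            · by_cases h2 : j = m <;> simp [h1, h2, gauss_m2]
        · rw [Finset.prod_eq_zero (Finset.mem_univ j)]
          · simp [hij, hjk, hik]
          · simpa [hij, Ne.symm hjk] using gauss_m1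
      · rw [Finset.prod_eq_zero (Finset.mem_univ i)]
        · simp [hij, hil, hik]
        · simpa [Ne.symm hij, Ne.symm hik, Ne.symm hil] using gauss_m1

lemma mon2_eq {p : ℕ} (i j : Fin p) (x : Fin p → ℝ) :
    x i * x j = ∏ m, x m ^ ((if i = m then 1 else 0) + (if j = m then 1 else 0)) := by
  simp only [pow_add, Finset.prod_mul_distrib, pow_ite, pow_one, pow_zero]
  simp

lemma mon2_integrable {p : ℕ} (i j : Fin p) :
    Integrable (fun x : Fin p → ℝ => x i * x j) (gvec p) := by
  simp_rw [mon2_eq]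
  exact Integrable.fintype_prod (f := fun m (y : ℝ) => y ^ ((if i = m then 1 else 0)
    + (if j = m then 1 else 0))) (fun m => gauss_integrable_pow _)

lemma mon2_integral {p : ℕ} (i j : Fin p) :
    ∫ x, x i * x j ∂(gvec p) = if i = j then 1 else 0 := by
  simp_rw [mon2_eq]
  rw [integral_fintype_prod_eq_prod (μ := fun _ : Fin p => gaussianReal 0 1)
    (fun m (y : ℝ) => y ^ ((if i = m then 1 else 0) + (if j = m then 1 else 0)))]
  by_cases hij : i = j
  · subst hij
    rw [Finset.prod_eq_one]
    · simp
    · intro m _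
      by_cases h1 : i = m <;> simp [h1, gauss_m2]
  · rw [Finset.prod_eq_zero (Finset.mem_univ i)]
    · simp [hij]
    · simpa [Ne.symm hij] using gauss_m1

lemma quad_eq {p : ℕ} (Q : Matrix (Fin p) (Fin p) ℝ) (x : Fin p → ℝ) :
    x ⬝ᵥ Q *ᵥ x = ∑ i, ∑ j, Q i j * (x i * x j) := by
  simp only [dotProduct, mulVec, Finset.mul_sum]
  exact Finset.sum_congr rfl fun i _ => Finset.sum_congr rfl fun j _ => by ring

lemma quad_sq_eq {p : ℕ} (Q : Matrix (Fin p) (Fin p) ℝ) (x : Fin p → ℝ) :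
    (x ⬝ᵥ Q *ᵥ x) ^ 2
      = ∑ i, ∑ j, ∑ k, ∑ l, Q i j * Q k l * (x i * x j * x k * x l) := by
  rw [quad_eq, sq, Finset.sum_mul]
  refine Finset.sum_congr rfl fun i _ => ?_
  rw [Finset.sum_mul]
  refine Finset.sum_congr rfl fun j _ => ?_
  rw [Finset.mul_sum]
  refine Finset.sum_congr rfl fun k _ => ?_
  rw [Finset.mul_sum]
  exact Finset.sum_congr rfl fun l _ => by ring

lemma quad_integral {p : ℕ} (Q : Matrix (Fin p) (Fin p) ℝ) :
    ∫ x, x ⬝ᵥ Q *ᵥ x ∂(gvec p) = Q.trace := by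
  simp_rw [quad_eq]
  have h : ∀ i j, Integrable (fun x : Fin p → ℝ => Q i j * (x i * x j)) (gvec p) :=
    fun i j => (mon2_integrable i j).const_mul _
  rw [integral_finsetSum _ fun i _ => integrable_finsetSum _ fun j _ => h i j]
  simp_rw [integral_finsetSum Finset.univ fun j _ => h _ j, integral_const_mul, mon2_integral]
  simp [Matrix.trace]

lemma quad_sq_integrable {p : ℕ} (Q : Matrix (Fin p) (Fin p) ℝ) :
    Integrable (fun x => (x ⬝ᵥ Q *ᵥ x) ^ 2) (gvec p) := by
  simp_rw [quad_sq_eq]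
  exact integrable_finsetSum _ fun i _ => integrable_finsetSum _ fun j _ =>
    integrable_finsetSum _ fun k _ => integrable_finsetSum _ fun l _ =>
      (mon4_integrable i j k l).const_mul _

lemma quad_sq_integral {p : ℕ} (Q : Matrix (Fin p) (Fin p) ℝ) (hQ : Qᵀ = Q) :
    ∫ x, (x ⬝ᵥ Q *ᵥ x) ^ 2 ∂(gvec p) = Q.trace ^ 2 + 2 * (Q * Q).trace := by
  simp_rw [quad_sq_eq]
  have h : ∀ i j k l, Integrable (fun x : Fin p → ℝ =>
      Q i j * Q k l * (x i * x j * x k * x l)) (gvec p) :=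
    fun i j k l => (mon4_integrable i j k l).const_mul _
  rw [integral_finsetSum _ fun i _ => integrable_finsetSum _ fun j _ =>
    integrable_finsetSum _ fun k _ => integrable_finsetSum _ fun l _ => h i j k l]
  simp_rw [integral_finsetSum Finset.univ fun j _ => integrable_finsetSum Finset.univ fun k _ =>
    integrable_finsetSum Finset.univ fun l _ => h _ j k l]
  simp_rw [integral_finsetSum Finset.univ fun k _ =>
    integrable_finsetSum Finset.univ fun l _ => h _ _ k l]
  simp_rw [integral_finsetSum Finset.univ fun l _ => h _ _ _ l, integral_const_mul, mon4_integral]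
  have hs : ∀ i j, Q j i = Q i j := fun i j => congrFun (congrFun hQ i) j
  simp only [mul_add, Finset.sum_add_distrib]
  have e1 : ∑ i, ∑ j, ∑ k, ∑ l, Q i j * Q k l *
      ((if i = j then (1 : ℝ) else 0) * (if k = l then 1 else 0)) = Q.trace ^ 2 := by
    simp only [Matrix.trace, sq, Finset.sum_mul_sum, mul_ite, mul_one, mul_zero, ite_mul, one_mul,
      zero_mul]
    simp [Finset.sum_ite_irrel]
  have e2 : ∑ i, ∑ j, ∑ k, ∑ l, Q i j * Q k l *
      ((if i = k then (1 : ℝ) else 0) * (if j = l then 1 else 0)) = (Q * Q).trace := by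
    simp [Matrix.trace, Matrix.mul_apply, hs, mul_ite, ite_mul]
  have e3 : ∑ i, ∑ j, ∑ k, ∑ l, Q i j * Q k l *
      ((if i = l then (1 : ℝ) else 0) * (if j = k then 1 else 0)) = (Q * Q).trace := by
    simp [Matrix.trace, Matrix.mul_apply]
  rw [e1, e2, e3]; ring

/-- The Gram determinant. -/
noncomputable def gdet {n p : ℕ} (G : Fin n → Fin p → ℝ) : ℝ :=
  (Matrix.of G * (Matrix.of G)ᵀ).det

lemma gram_apply {n p : ℕ} (G : Fin n → Fin p → ℝ) (i j : Fin n) :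
    (Matrix.of G * (Matrix.of G)ᵀ) i j = G i ⬝ᵥ G j := by
  simp [Matrix.mul_apply, dotProduct]

lemma gdet_cons_singular {n p : ℕ} (G : Fin n → Fin p → ℝ) (g : Fin p → ℝ) (h : gdet G = 0) :
    gdet (Fin.cons g G : Fin (n + 1) → Fin p → ℝ) = 0 := by
  obtain ⟨v, hv, hv0⟩ := Matrix.exists_vecMul_eq_zero_iff.mpr h
  have h1 : v ᵥ* Matrix.of G = 0 := by
    have : (v ᵥ* Matrix.of G) ⬝ᵥ (v ᵥ* Matrix.of G) = 0 := by
      conv_lhs => rhs; rw [← Matrix.mulVec_transpose]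
      rw [Matrix.dotProduct_mulVec, Matrix.vecMul_vecMul, hv0, zero_dotProduct]
    exact dotProduct_self_eq_zero.mp this
  refine Matrix.exists_vecMul_eq_zero_iff.mp ⟨Fin.cons 0 v, ?_, ?_⟩
  · intro h0
    apply hv
    funext i
    simpa using congrFun h0 i.succ
  · rw [← Matrix.vecMul_vecMul]
    have : (Fin.cons 0 v : Fin (n + 1) → ℝ) ᵥ*
        Matrix.of (Fin.cons g G : Fin (n + 1) → Fin p → ℝ) = 0 := by
      funext j
      have := congrFun h1 j
      simpa [Matrix.vecMul, dotProduct, Fin.sum_univ_succ] using this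
    rw [this, Matrix.zero_vecMul]

/-- The projection on the orthogonal complement of the rows. -/
noncomputable def projc {n p : ℕ} (G : Fin n → Fin p → ℝ) : Matrix (Fin p) (Fin p) ℝ :=
  1 - (Matrix.of G)ᵀ * (Matrix.of G * (Matrix.of G)ᵀ)⁻¹ * Matrix.of G

lemma projc_symm {n p : ℕ} (G : Fin n → Fin p → ℝ) : (projc G)ᵀ = projc G := by
  simp [projc, Matrix.transpose_mul, Matrix.transpose_nonsing_inv, Matrix.mul_assoc]

lemma projc_trace {n p : ℕ} (G : Fin n → Fin p → ℝ) (h : gdet G ≠ 0) :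
    (projc G).trace = (p : ℝ) - n := by
  have hu : IsUnit (Matrix.of G * (Matrix.of G)ᵀ).det := isUnit_iff_ne_zero.mpr h
  rw [projc, Matrix.trace_sub, Matrix.trace_mul_comm, ← Matrix.mul_assoc,
    Matrix.mul_nonsing_inv _ hu]
  simp

lemma projc_sq {n p : ℕ} (G : Fin n → Fin p → ℝ) (h : gdet G ≠ 0) :
    projc G * projc G = projc G := by
  have hu : IsUnit (Matrix.of G * (Matrix.of G)ᵀ).det := isUnit_iff_ne_zero.mpr h
  have key : ((Matrix.of G)ᵀ * (Matrix.of G * (Matrix.of G)ᵀ)⁻¹ * Matrix.of G) *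
      ((Matrix.of G)ᵀ * (Matrix.of G * (Matrix.of G)ᵀ)⁻¹ * Matrix.of G) =
      (Matrix.of G)ᵀ * (Matrix.of G * (Matrix.of G)ᵀ)⁻¹ * Matrix.of G := by
    calc _ = (Matrix.of G)ᵀ * ((Matrix.of G * (Matrix.of G)ᵀ)⁻¹ * (Matrix.of G * (Matrix.of G)ᵀ))
          * (Matrix.of G * (Matrix.of G)ᵀ)⁻¹ * Matrix.of G := by simp only [Matrix.mul_assoc]
      _ = _ := by rw [Matrix.nonsing_inv_mul _ hu, Matrix.mul_one]
  rw [projc, sub_mul, mul_sub, mul_sub, key]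
  simp

lemma gdet_cons {n p : ℕ} (G : Fin n → Fin p → ℝ) (g : Fin p → ℝ) (h : gdet G ≠ 0) :
    gdet (Fin.cons g G : Fin (n + 1) → Fin p → ℝ) = gdet G * (g ⬝ᵥ projc G *ᵥ g) := by
  have hu : IsUnit (Matrix.of G * (Matrix.of G)ᵀ).det := isUnit_iff_ne_zero.mpr h
  let e : Fin n ⊕ Unit ≃ Fin (n + 1) :=
    (Equiv.optionEquivSumPUnit (Fin n)).symm.trans (finSuccEquiv n).symm
  have he1 : ∀ i, e (Sum.inl i) = i.succ := fun i => by simp [e]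
  have he2 : ∀ i, e (Sum.inr i) = 0 := fun i => by simp [e]
  letI : Invertible (Matrix.of G * (Matrix.of G)ᵀ) := Matrix.invertibleOfIsUnitDet _ hu
  have hb : (Matrix.of (Fin.cons g G : Fin (n + 1) → Fin p → ℝ) *
      (Matrix.of (Fin.cons g G : Fin (n + 1) → Fin p → ℝ))ᵀ).submatrix e e =
      Matrix.fromBlocks (Matrix.of G * (Matrix.of G)ᵀ)
        (Matrix.replicateCol Unit (Matrix.of G *ᵥ g)) (Matrix.replicateRow Unit (Matrix.of G *ᵥ g))
        (Matrix.of fun _ _ : Unit => g ⬝ᵥ g) := by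
    ext i j
    rw [Matrix.submatrix_apply, gram_apply]
    rcases i with i | i <;> rcases j with j | j
    · simp [he1, gram_apply]
    · simp [he1, he2, Matrix.mulVec]
    · simp [he1, he2, Matrix.mulVec, dotProduct_comm]
    · simp [he2]
  rw [gdet, ← Matrix.det_submatrix_equiv_self e, hb, Matrix.det_fromBlocks₁₁, gdet]
  congr 1
  rw [Matrix.det_unique, projc, Matrix.sub_mulVec, dotProduct_sub, Matrix.one_mulVec,
    Matrix.sub_apply, Matrix.of_apply, Matrix.invOf_eq_nonsing_inv]
  congr 1
  rw [← Matrix.mulVec_mulVec, ← Matrix.mulVec_mulVec, Matrix.dotProduct_mulVec,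
    Matrix.vecMul_transpose, Matrix.mul_assoc]
  simp [Matrix.mul_apply, dotProduct, Matrix.mulVec]

lemma gdet_continuous (n p : ℕ) : Continuous (fun G : Fin n → Fin p → ℝ => gdet G) := by
  unfold gdet
  have : Continuous fun G : Fin n → Fin p → ℝ => (Matrix.of G : Matrix (Fin n) (Fin p) ℝ) :=
    continuous_id
  exact (this.matrix_mul this.matrix_transpose).matrix_det

/-- Gaussian matrices. -/
noncomputable abbrev gmat (n p : ℕ) : Measure (Fin n → Fin p → ℝ) :=
  Measure.pi fun _ : Fin n => gvec p

lemma slice_one {n p : ℕ} (G : Fin n → Fin p → ℝ) :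
    ∫ g, gdet (Fin.cons g G : Fin (n + 1) → Fin p → ℝ) ∂(gvec p) = ((p : ℝ) - n) * gdet G := by
  by_cases h : gdet G = 0
  · simp [gdet_cons_singular G _ h, h]
  · simp_rw [gdet_cons G _ h]
    rw [integral_const_mul, quad_integral, projc_trace G h]; ring

lemma slice_two {n p : ℕ} (G : Fin n → Fin p → ℝ) :
    Integrable (fun g => gdet (Fin.cons g G : Fin (n + 1) → Fin p → ℝ) ^ 2) (gvec p) ∧
    ∫ g, gdet (Fin.cons g G : Fin (n + 1) → Fin p → ℝ) ^ 2 ∂(gvec p)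
      = ((p : ℝ) - n) * ((p : ℝ) - n + 2) * gdet G ^ 2 := by
  by_cases h : gdet G = 0
  · simp [gdet_cons_singular G _ h, h]
  · simp_rw [gdet_cons G _ h, mul_pow]
    refine ⟨(quad_sq_integrable _).const_mul _, ?_⟩
    rw [integral_const_mul, quad_sq_integral _ (projc_symm G), projc_sq G h, projc_trace G h]; ring

lemma cons_coe (n p : ℕ) :
    ⇑(MeasurableEquiv.piFinSuccAbove (fun _ : Fin (n + 1) => Fin p → ℝ) 0).symm =
    (fun z : (Fin p → ℝ) × (Fin n → Fin p → ℝ) =>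
      (Fin.cons z.1 z.2 : Fin (n + 1) → Fin p → ℝ)) := by
  funext z
  simp [MeasurableEquiv.piFinSuccAbove]
  rfl

lemma cons_mp (n p : ℕ) : MeasurePreserving
    (fun z : (Fin p → ℝ) × (Fin n → Fin p → ℝ) => (Fin.cons z.1 z.2 : Fin (n + 1) → Fin p → ℝ))
    ((gvec p).prod (gmat n p)) (gmat (n + 1) p) := by
  have := (measurePreserving_piFinSuccAbove (fun _ : Fin (n + 1) => gvec p) 0).symm
  rw [cons_coe] at this
  exact this

lemma cons_me (n p : ℕ) : MeasurableEmbedding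
    (fun z : (Fin p → ℝ) × (Fin n → Fin p → ℝ) => (Fin.cons z.1 z.2 : Fin (n + 1) → Fin p → ℝ)) := by
  rw [← cons_coe]
  exact MeasurableEquiv.measurableEmbedding _

lemma gdet_moment (n p : ℕ) :
    Integrable (fun G => gdet G ^ 2) (gmat n p) ∧
    ∫ G, gdet G ^ 2 ∂(gmat n p)
      = ∏ k ∈ Finset.range n, (((p : ℝ) - k) * ((p : ℝ) - k + 2)) ∧
    ∫ G, gdet G ∂(gmat n p) = ∏ k ∈ Finset.range n, ((p : ℝ) - k) := by
  induction n with
  | zero => simp [gdet]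
  | succ n ih =>
    obtain ⟨ih1, ih2, ih3⟩ := ih
    have hI2 : Integrable (fun z : (Fin p → ℝ) × (Fin n → Fin p → ℝ) =>
        gdet (Fin.cons z.1 z.2 : Fin (n + 1) → Fin p → ℝ) ^ 2) ((gvec p).prod (gmat n p)) := by
      rw [integrable_prod_iff']
      · refine ⟨Filter.Eventually.of_forall fun G => (slice_two G).1, ?_⟩
        simp only [norm_pow, Real.norm_eq_abs, sq_abs]
        simp_rw [(slice_two _).2]
        exact ih1.const_mul _
      · exact ((gdet_continuous (n + 1) p).pow 2 |>.measurable.comp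
          (cons_me n p).measurable).aestronglyMeasurable
    have hI1 : Integrable (fun z : (Fin p → ℝ) × (Fin n → Fin p → ℝ) =>
        gdet (Fin.cons z.1 z.2 : Fin (n + 1) → Fin p → ℝ)) ((gvec p).prod (gmat n p)) := by
      have hm : AEStronglyMeasurable (fun z : (Fin p → ℝ) × (Fin n → Fin p → ℝ) =>
          gdet (Fin.cons z.1 z.2 : Fin (n + 1) → Fin p → ℝ)) ((gvec p).prod (gmat n p)) :=
        ((gdet_continuous (n + 1) p).measurable.comp (cons_me n p).measurable).aestronglyMeasurable
      exact ((memLp_two_iff_integrable_sq hm).mpr hI2).integrable (by norm_num)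
    refine ⟨?_, ?_, ?_⟩
    · exact ((cons_mp n p).integrable_comp_emb (cons_me n p)).mp hI2
    · rw [← (cons_mp n p).integral_comp (cons_me n p), integral_prod_symm _ hI2]
      simp_rw [(slice_two _).2]
      rw [integral_const_mul, ih2, Finset.prod_range_succ]; ring
    · rw [← (cons_mp n p).integral_comp (cons_me n p), integral_prod_symm _ hI1]
      simp_rw [slice_one]
      rw [integral_const_mul, ih3, Finset.prod_range_succ]; ring

lemma prod_fact (n p : ℕ) (h : n ≤ p) :
    ∏ k ∈ Finset.range n, ((p : ℝ) - k) = (p ! : ℝ) / ((p - n)! : ℝ) := by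
  induction n with
  | zero => simp [Nat.factorial_ne_zero]
  | succ n ih =>
    rw [Finset.prod_range_succ, ih (by omega)]
    obtain ⟨m, rfl⟩ : ∃ m, p = n + 1 + m := ⟨p - (n + 1), by omega⟩
    have e1 : n + 1 + m - n = m + 1 := by omega
    have e2 : n + 1 + m - (n + 1) = m := by omega
    rw [e1, e2, Nat.factorial_succ m]
    have : (m ! : ℝ) ≠ 0 := by exact_mod_cast Nat.factorial_ne_zero m
    have : (m : ℝ) + 1 ≠ 0 := by positivity
    push_cast
    field_simp
    ring


/-- If `W ∼ W_n(Id, p)` with `n ≤ p`, then `E[(det W)²] = (p!/(p-n)!)·((p+2)!/(p+2-n)!)`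
and hence `Var[det W] = (p!/(p-n)!)·((p+2)!/(p+2-n)! - p!/(p-n)!)`. -/
theorem wishart_det_second_moment (n p : ℕ) (hnp : n ≤ p) :
    (∫ A, A.det ^ 2 ∂(wishart n p) =
        ((p ! : ℝ) / ((p - n)! : ℝ)) * (((p + 2)! : ℝ) / ((p + 2 - n)! : ℝ))) ∧
    variance (fun A => A.det) (wishart n p) =
      ((p ! : ℝ) / ((p - n)! : ℝ)) *
        (((p + 2)! : ℝ) / ((p + 2 - n)! : ℝ) - (p ! : ℝ) / ((p - n)! : ℝ)) := by
  have hmeas : Measurable fun G : Fin n → Fin p → ℝ => Matrix.of G * (Matrix.of G)ᵀ := by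
    refine measurable_pi_iff.mpr fun i => measurable_pi_iff.mpr fun j => ?_
    simp_rw [gram_apply]
    unfold dotProduct
    fun_prop
  have hdet : Measurable fun A : Matrix (Fin n) (Fin n) ℝ => A.det := by
    have hij : ∀ i j, Measurable fun A : Matrix (Fin n) (Fin n) ℝ => A i j := fun i j =>
      (measurable_pi_apply j).comp (measurable_pi_apply (X := fun _ : Fin n => Fin n → ℝ) i)
    simp_rw [Matrix.det_apply']
    exact Finset.measurable_sum _ fun σ _ =>
      (Finset.measurable_prod _ fun i _ => hij _ _).const_mul _
  obtain ⟨h1, h2, h3⟩ := gdet_moment n p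
  have hsec : ∫ A, A.det ^ 2 ∂(wishart n p) =
      ((p ! : ℝ) / ((p - n)! : ℝ)) * (((p + 2)! : ℝ) / ((p + 2 - n)! : ℝ)) := by
    rw [wishart, integral_map hmeas.aemeasurable (hdet.pow_const 2).aestronglyMeasurable]
    refine h2.trans ?_
    rw [Finset.prod_mul_distrib, prod_fact n p hnp, ← prod_fact n (p + 2) (by omega)]
    congr 1
    exact Finset.prod_congr rfl fun k _ => by push_cast; ring
  have hfst : ∫ A, A.det ∂(wishart n p) = (p ! : ℝ) / ((p - n)! : ℝ) := by
    rw [wishart, integral_map hmeas.aemeasurable hdet.aestronglyMeasurable]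
    exact h3.trans (prod_fact n p hnp)
  have hint : Integrable (fun A => A.det ^ 2) (wishart n p) := by
    rw [wishart, integrable_map_measure (hdet.pow_const 2).aestronglyMeasurable hmeas.aemeasurable]
    exact h1
  haveI : IsProbabilityMeasure (wishart n p) :=
    Measure.isProbabilityMeasure_map hmeas.aemeasurable
  refine ⟨hsec, ?_⟩
  rw [variance_eq_sub ((memLp_two_iff_integrable_sq hdet.aestronglyMeasurable).mpr hint)]
  simp only [Pi.pow_apply]
  rw [hsec, hfst]
  ring
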